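/- arXiv:2108.12647 — 2 statements merged into one kernel-verified Lean document; each statement's English description precedes it below -/
import Mathlib

section
/- (Strong additivity of mutual information.) Let p : 𝒳 → [0,1] be a probability distribution on a finite set 𝒳 and let (Y^x, Z^x) (x ∈ 𝒳) be a family of pairs of finite random variables on a probability space (Ω, Σ, μ). Then I(⊕_{x∈𝒳} p(x)(Y^x, Z^x)) = H(p) + ∑_{x∈𝒳} p(x)·I(Y^x, Z^x), where H(p) = -∑_{x∈𝒳} p(x) log p(x) is the Shannon entropy of the distribution p. -/
open MeasureTheory Filter Topology

/-- A finite random variable on a measurable space `Ω`: a map into a finite set whose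
fibers are measurable. -/
structure FRV (Ω : Type) [MeasurableSpace Ω] where
  α : Type
  fintype : Fintype α
  X : Ω → α
  meas : ∀ a : α, MeasurableSet (X ⁻¹' {a})

attribute [instance] FRV.fintype

/-- A probability distribution on a finite set. -/
def IsProbDist {β : Type} [Fintype β] (p : β → ℝ) : Prop :=
  (∀ b, 0 ≤ p b) ∧ ∑ b, p b = 1

/-- Shannon entropy of a distribution on a finite set. -/
noncomputable def entropyOfDist {β : Type} [Fintype β] (p : β → ℝ) : ℝ :=
  -∑ b, p b * Real.log (p b)

namespace FRV

variable {Ω Ω' : Type} [MeasurableSpace Ω] [MeasurableSpace Ω']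

/-- The probability mass function of a finite random variable. -/
noncomputable def pmf (μ : Measure Ω) (X : FRV Ω) : X.α → ℝ :=
  fun a => (μ (X.X ⁻¹' {a})).toReal

/-- The Shannon entropy of a finite random variable. -/
noncomputable def entropy (μ : Measure Ω) (X : FRV Ω) : ℝ :=
  entropyOfDist (X.pmf μ)

/-- The canonical product `𝒫(X,Y)` of two finite random variables on a common space. -/
def prod (X Y : FRV Ω) : FRV Ω where
  α := X.α × Y.α
  fintype := inferInstance
  X := fun ω => (X.X ω, Y.X ω)
  meas := by
    rintro ⟨a, b⟩
    have h : (fun ω => (X.X ω, Y.X ω)) ⁻¹' {(a, b)} = X.X ⁻¹' {a} ∩ Y.X ⁻¹' {b} := by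
      ext ω; simp [Prod.ext_iff]
    rw [h]
    exact (X.meas a).inter (Y.meas b)

/-- Post-composition of a finite random variable with a map of finite sets. -/
def map (X : FRV Ω) {β : Type} [Fintype β] (f : X.α → β) : FRV Ω where
  α := β
  fintype := inferInstance
  X := f ∘ X.X
  meas := by
    intro b
    have h : (f ∘ X.X) ⁻¹' {b} = ⋃ a ∈ {a | f a = b}, X.X ⁻¹' {a} := by
      ext ω; simp
    rw [h]
    exact MeasurableSet.biUnion (Set.to_countable _) fun a _ => X.meas a

/-- Pullback of a finite random variable along a measurable map. -/
def comap (X : FRV Ω) (π : Ω' → Ω) (hπ : Measurable π) : FRV Ω' where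
  α := X.α
  fintype := X.fintype
  X := X.X ∘ π
  meas := by
    intro a
    rw [Set.preimage_comp]
    exact hπ (X.meas a)

/-- A constant random variable: one whose support is a one-element set. -/
def IsConstant (C : FRV Ω) : Prop := ∀ a b : C.α, a = b

/-- Weak convergence (convergence in distribution) of a sequence of finite random
variables: eventually the supports coincide, and the probability mass functions
converge pointwise. -/
def WeakConv (μ : Measure Ω) (Xs : ℕ → FRV Ω) (X : FRV Ω) : Prop :=
  (∃ N, ∀ n ≥ N, (Xs n).α = X.α) ∧
  ∀ a : X.α,
    Tendsto
      (fun n => @dite _ ((Xs n).α = X.α) (Classical.dec _)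
        (fun h => (Xs n).pmf μ (cast h.symm a)) (fun _ => 0))
      atTop (𝓝 (X.pmf μ a))

/-- Weak convergence of a sequence of pairs of finite random variables: weak convergence
of the canonical products. -/
def WeakConvPair (μ : Measure Ω) (Xs Ys : ℕ → FRV Ω) (X Y : FRV Ω) : Prop :=
  WeakConv μ (fun n => (Xs n).prod (Ys n)) (X.prod Y)

/-- The discrete measure on a finite set associated with a real-valued weight function. -/
noncomputable def discMeasure {𝒳 : Type} [Fintype 𝒳] [MeasurableSpace 𝒳] (p : 𝒳 → ℝ) :
    Measure 𝒳 :=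
  Measure.sum fun x => ENNReal.ofReal (p x) • Measure.dirac x

/-- The `p`-weighted convex sum of a family of finite random variables, a random variable
on `𝒳 × Ω` valued in the disjoint union `Σ x, 𝒴ˣ` (the weights `p` enter through the
product measure `(discMeasure p).prod μ` on `𝒳 × Ω`). -/
def convexSum {𝒳 : Type} [Fintype 𝒳] [MeasurableSpace 𝒳] [MeasurableSingletonClass 𝒳]
    (Y : 𝒳 → FRV Ω) : FRV (𝒳 × Ω) where
  α := Σ x : 𝒳, (Y x).α
  fintype := inferInstance
  X := fun q => ⟨q.1, (Y q.1).X q.2⟩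
  meas := by
    rintro ⟨x₀, y₀⟩
    have h : (fun q : 𝒳 × Ω => (⟨q.1, (Y q.1).X q.2⟩ : Σ x : 𝒳, (Y x).α)) ⁻¹' {⟨x₀, y₀⟩}
        = {x₀} ×ˢ ((Y x₀).X ⁻¹' {y₀}) := by
      ext ⟨x, ω⟩
      simp only [Set.mem_preimage, Set.mem_singleton_iff, Set.mem_prod, Sigma.mk.inj_iff]
      constructor
      · rintro ⟨rfl, h2⟩
        exact ⟨rfl, eq_of_heq h2⟩
      · rintro ⟨rfl, h2⟩
        exact ⟨rfl, heq_of_eq h2⟩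
    rw [h]
    exact (measurableSet_singleton x₀).prod ((Y x₀).meas y₀)

end FRV

section InfoMeasures

variable {Ω : Type} [MeasurableSpace Ω]

/-- The joint distribution function `ϑ(x,y) = μ(X⁻¹{x} ∩ Y⁻¹{y})` of a pair of finite
random variables. -/
noncomputable def jointDist (μ : Measure Ω) (X Y : FRV Ω) : X.α → Y.α → ℝ :=
  fun a b => (μ (X.X ⁻¹' {a} ∩ Y.X ⁻¹' {b})).toReal

/-- The joint entropy `H(X,Y)` of a pair of finite random variables. -/
noncomputable def jointEntropy (μ : Measure Ω) (X Y : FRV Ω) : ℝ :=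
  -∑ a, ∑ b, jointDist μ X Y a b * Real.log (jointDist μ X Y a b)

/-- The mutual information `I(X,Y) = H(X) + H(Y) - H(X,Y)`. -/
noncomputable def mutualInfo (μ : Measure Ω) (X Y : FRV Ω) : ℝ :=
  X.entropy μ + Y.entropy μ - jointEntropy μ X Y

/-- The conditional distribution `q(y|x)` of `Y` given `X = x`. -/
noncomputable def condDist (μ : Measure Ω) (X Y : FRV Ω) : X.α → Y.α → ℝ :=
  fun a b => if X.pmf μ a ≠ 0 then jointDist μ X Y a b / X.pmf μ a else 0

/-- The conditional entropy `H(Y|X) = ∑ₓ p(x) H(q(·|x))`. -/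
noncomputable def condEntropy (μ : Measure Ω) (X Y : FRV Ω) : ℝ :=
  ∑ a, X.pmf μ a * entropyOfDist (condDist μ X Y a)

/-- `h : 𝒵 × 𝒳 → 𝒴` is a mediator function for the triple `(X, Y, Z)` if
`r(z|x) = p(z|h(z,x)) · q(h(z,x)|x)` for all `(z,x)`. -/
def IsMediator (μ : Measure Ω) (X Y Z : FRV Ω) (h : Z.α × X.α → Y.α) : Prop :=
  ∀ z x, condDist μ X Z x z = condDist μ Y Z (h (z, x)) z * condDist μ X Y x (h (z, x))

/-- A triple `(X, Y, Z)` of finite random variables is a Markov triangle if it admits a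
mediator function. -/
def IsMarkovTriangle (μ : Measure Ω) (X Y Z : FRV Ω) : Prop :=
  ∃ h : Z.α × X.α → Y.α, IsMediator μ X Y Z h

end InfoMeasures

/-- A map assigning a real number to every ordered pair of finite random variables
defined on a common probability space. -/
abbrev PairFunctional :=
  ∀ (Ω : Type) [MeasurableSpace Ω], Measure Ω → FRV Ω → FRV Ω → ℝ

namespace PF

/-- `F` is non-negative. -/
def Nonneg (F : PairFunctional) : Prop :=
  ∀ (Ω : Type) [MeasurableSpace Ω] (μ : Measure Ω) [IsProbabilityMeasure μ]
    (X Y : FRV Ω), 0 ≤ F Ω μ X Y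

/-- `F` is symmetric. -/
def Symm (F : PairFunctional) : Prop :=
  ∀ (Ω : Type) [MeasurableSpace Ω] (μ : Measure Ω) [IsProbabilityMeasure μ]
    (X Y : FRV Ω), F Ω μ X Y = F Ω μ Y X

/-- `F` is continuous: it respects weak convergence of pairs. -/
def Continuous (F : PairFunctional) : Prop :=
  ∀ (Ω : Type) [MeasurableSpace Ω] (μ : Measure Ω) [IsProbabilityMeasure μ]
    (Xs Ys : ℕ → FRV Ω) (X Y : FRV Ω), FRV.WeakConvPair μ Xs Ys X Y →
    Tendsto (fun n => F Ω μ (Xs n) (Ys n)) atTop (𝓝 (F Ω μ X Y))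

/-- `F` is weakly functorial: `F(X,Z) = F(X,Y) + F(Y,Z) - F(Y,Y)` on Markov triangles. -/
def WeaklyFunctorial (F : PairFunctional) : Prop :=
  ∀ (Ω : Type) [MeasurableSpace Ω] (μ : Measure Ω) [IsProbabilityMeasure μ]
    (X Y Z : FRV Ω), IsMarkovTriangle μ X Y Z →
    F Ω μ X Z = F Ω μ X Y + F Ω μ Y Z - F Ω μ Y Y

/-- `F` is invariant under pullbacks along measure-preserving maps. -/
def PullbackInvariant (F : PairFunctional) : Prop :=
  ∀ (Ω Ω' : Type) [MeasurableSpace Ω] [MeasurableSpace Ω']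
    (μ : Measure Ω) (μ' : Measure Ω') [IsProbabilityMeasure μ] [IsProbabilityMeasure μ']
    (π : Ω' → Ω) (hπ : MeasurePreserving π μ' μ) (X Y : FRV Ω),
    F Ω μ X Y = F Ω' μ' (X.comap π hπ.measurable) (Y.comap π hπ.measurable)

/-- `F(X,C) = 0` for every constant random variable `C`. -/
def VanishesOnConstants (F : PairFunctional) : Prop :=
  ∀ (Ω : Type) [MeasurableSpace Ω] (μ : Measure Ω) [IsProbabilityMeasure μ]
    (X C : FRV Ω), C.IsConstant → F Ω μ X C = 0

/-- `F` is strongly additive: for a finite random variable `X` with probability mass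
function `p` and a family of pairs `(Yˣ, Zˣ)` indexed by the support of `X`,
`F(⊕ₓ p(x)(Yˣ,Zˣ)) = F(X,X) + ∑ₓ p(x) F(Yˣ,Zˣ)`. -/
def StronglyAdditive (F : PairFunctional) : Prop :=
  ∀ (Ω : Type) [MeasurableSpace Ω] (μ : Measure Ω) [IsProbabilityMeasure μ]
    (X : FRV Ω) (Y Z : X.α → FRV Ω),
    letI : MeasurableSpace X.α := ⊤
    letI : MeasurableSingletonClass X.α := ⟨fun _ => MeasurableSpace.measurableSet_top⟩
    F (X.α × Ω) ((FRV.discMeasure (X.pmf μ)).prod μ) (FRV.convexSum Y) (FRV.convexSum Z)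
      = F Ω μ X X + ∑ x, X.pmf μ x * F Ω μ (Y x) (Z x)

end PF

/-- Mutual information as a pair functional. -/
noncomputable def MIfun : PairFunctional := fun _ _ μ X Y => mutualInfo μ X Y

/-- The chain rule for a discrete distribution scaled by a constant. -/
theorem sum_negMulLog_const_mul {β : Type} [Fintype β] (c : ℝ) {q : β → ℝ}
    (hq : ∑ b, q b = 1) :
    ∑ b, Real.negMulLog (c * q b) = Real.negMulLog c + c * ∑ b, Real.negMulLog (q b) := by
  simp_rw [Real.negMulLog_mul, Finset.sum_add_distrib, ← Finset.sum_mul, ← Finset.mul_sum, hq,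
    one_mul]

theorem entropyOfDist_eq_sum_negMulLog {β : Type} [Fintype β] (p : β → ℝ) :
    entropyOfDist p = ∑ b, Real.negMulLog (p b) := by
  simp [entropyOfDist, Real.negMulLog]

namespace FRV

section Pmf

variable {Ω : Type} [MeasurableSpace Ω]

theorem sum_pmf (μ : Measure Ω) [IsProbabilityMeasure μ] (X : FRV Ω) : ∑ a, X.pmf μ a = 1 := by
  simpa [pmf, measureReal_def] using
    sum_measureReal_preimage_singleton (μ := μ) Finset.univ fun a _ => X.meas a

/-- A pair of values, as a value of the product random variable. -/
def pair (X Y : FRV Ω) (a : X.α) (b : Y.α) : (X.prod Y).α := (a, b)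

theorem sum_prod (X Y : FRV Ω) (f : (X.prod Y).α → ℝ) :
    ∑ c, f c = ∑ a, ∑ b, f (pair X Y a b) :=
  Fintype.sum_prod_type _

theorem pmf_prod (μ : Measure Ω) (X Y : FRV Ω) (a : X.α) (b : Y.α) :
    (X.prod Y).pmf μ (pair X Y a b) = jointDist μ X Y a b := by
  have h : (X.prod Y).X ⁻¹' {pair X Y a b} = X.X ⁻¹' {a} ∩ Y.X ⁻¹' {b} :=
    Set.ext fun _ => Prod.mk_inj
  simp only [pmf, jointDist, h]

theorem jointEntropy_eq_entropy_prod (μ : Measure Ω) (X Y : FRV Ω) :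
    jointEntropy μ X Y = (X.prod Y).entropy μ := by
  simp only [jointEntropy, entropy, entropyOfDist, sum_prod, pmf_prod]

end Pmf

section ConvexSum

variable {Ω 𝒳 : Type} [MeasurableSpace Ω] [Fintype 𝒳] [MeasurableSpace 𝒳]
  [MeasurableSingletonClass 𝒳]

theorem discMeasure_singleton (p : 𝒳 → ℝ) (x : 𝒳) :
    discMeasure p {x} = ENNReal.ofReal (p x) := by
  classical
  simp [discMeasure, Set.indicator_apply]

/-- The inclusion of the values of a summand into the values of a convex sum. -/
def incl (Y : 𝒳 → FRV Ω) (x : 𝒳) (y : (Y x).α) : (convexSum Y).α := ⟨x, y⟩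

theorem sum_convexSum (Y : 𝒳 → FRV Ω) (f : (convexSum Y).α → ℝ) :
    ∑ c, f c = ∑ x, ∑ y, f (incl Y x y) :=
  Fintype.sum_sigma _

theorem convexSum_preimage (Y : 𝒳 → FRV Ω) (x : 𝒳) (y : (Y x).α) :
    (convexSum Y).X ⁻¹' {incl Y x y} = {x} ×ˢ ((Y x).X ⁻¹' {y}) := by
  ext ⟨x', ω⟩
  refine Sigma.mk.inj_iff.trans ⟨?_, ?_⟩
  · rintro ⟨rfl, h⟩
    exact ⟨rfl, eq_of_heq h⟩
  · rintro ⟨rfl, h⟩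
    exact ⟨rfl, heq_of_eq h⟩

theorem pmf_convexSum (μ : Measure Ω) [SFinite μ] {p : 𝒳 → ℝ} (hp : ∀ x, 0 ≤ p x)
    (Y : 𝒳 → FRV Ω) (x : 𝒳) (y : (Y x).α) :
    (convexSum Y).pmf ((discMeasure p).prod μ) (incl Y x y) = p x * (Y x).pmf μ y := by
  rw [pmf, convexSum_preimage, Measure.prod_prod, discMeasure_singleton, ENNReal.toReal_mul,
    ENNReal.toReal_ofReal (hp x), pmf]

theorem jointDist_convexSum_self (μ : Measure Ω) [SFinite μ] {p : 𝒳 → ℝ} (hp : ∀ x, 0 ≤ p x)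
    (Y Z : 𝒳 → FRV Ω) (x : 𝒳) (y : (Y x).α) (z : (Z x).α) :
    jointDist ((discMeasure p).prod μ) (convexSum Y) (convexSum Z) (incl Y x y) (incl Z x z)
      = p x * jointDist μ (Y x) (Z x) y z := by
  rw [jointDist, convexSum_preimage, convexSum_preimage, Set.prod_inter_prod, Set.inter_self,
    Measure.prod_prod, discMeasure_singleton, ENNReal.toReal_mul, ENNReal.toReal_ofReal (hp x),
    jointDist]

theorem jointDist_convexSum_of_ne (ν : Measure (𝒳 × Ω)) (Y Z : 𝒳 → FRV Ω) {x x' : 𝒳}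
    (h : x ≠ x') (y : (Y x).α) (z : (Z x').α) :
    jointDist ν (convexSum Y) (convexSum Z) (incl Y x y) (incl Z x' z) = 0 := by
  rw [jointDist, convexSum_preimage, convexSum_preimage, Set.prod_inter_prod,
    Set.singleton_inter_eq_empty.mpr (by simpa using h)]
  simp

/-- Strong additivity of Shannon entropy. -/
theorem entropy_convexSum (μ : Measure Ω) [IsProbabilityMeasure μ] {p : 𝒳 → ℝ}
    (hp : ∀ x, 0 ≤ p x) (Y : 𝒳 → FRV Ω) :
    (convexSum Y).entropy ((discMeasure p).prod μ)
      = entropyOfDist p + ∑ x, p x * (Y x).entropy μ := by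
  simp_rw [entropy, entropyOfDist_eq_sum_negMulLog, sum_convexSum, pmf_convexSum μ hp,
    sum_negMulLog_const_mul _ (sum_pmf μ _), Finset.sum_add_distrib]

/-- The joint entropy of two convex sums is that of the convex sum of the products. -/
theorem jointEntropy_convexSum_eq_entropy (μ : Measure Ω) [SFinite μ] {p : 𝒳 → ℝ}
    (hp : ∀ x, 0 ≤ p x) (Y Z : 𝒳 → FRV Ω) :
    jointEntropy ((discMeasure p).prod μ) (convexSum Y) (convexSum Z)
      = (convexSum fun x => (Y x).prod (Z x)).entropy ((discMeasure p).prod μ) := by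
  simp_rw [jointEntropy, entropy, entropyOfDist, sum_convexSum, pmf_convexSum μ hp, sum_prod,
    pmf_prod]
  refine congrArg Neg.neg (Finset.sum_congr rfl fun x _ => Finset.sum_congr rfl fun y _ => ?_)
  rw [Fintype.sum_eq_single x fun x' hx' => ?_]
  · simp_rw [jointDist_convexSum_self μ hp]
  · simp [jointDist_convexSum_of_ne _ Y Z hx'.symm]

/-- Strong additivity of joint entropy. -/
theorem jointEntropy_convexSum (μ : Measure Ω) [IsProbabilityMeasure μ] {p : 𝒳 → ℝ}
    (hp : ∀ x, 0 ≤ p x) (Y Z : 𝒳 → FRV Ω) :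
    jointEntropy ((discMeasure p).prod μ) (convexSum Y) (convexSum Z)
      = entropyOfDist p + ∑ x, p x * jointEntropy μ (Y x) (Z x) := by
  simp_rw [jointEntropy_convexSum_eq_entropy μ hp, entropy_convexSum μ hp,
    jointEntropy_eq_entropy_prod]

end ConvexSum

end FRV

/-- Strong additivity of mutual information:
`I(⊕ₓ p(x)(Yˣ,Zˣ)) = H(p) + ∑ₓ p(x) I(Yˣ,Zˣ)`. -/
theorem mutualInfo_convexSum {Ω : Type} [MeasurableSpace Ω] (μ : Measure Ω)
    [IsProbabilityMeasure μ] {𝒳 : Type} [Fintype 𝒳] [MeasurableSpace 𝒳]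
    [MeasurableSingletonClass 𝒳] (p : 𝒳 → ℝ) (hp : IsProbDist p) (Y Z : 𝒳 → FRV Ω) :
    mutualInfo ((FRV.discMeasure p).prod μ) (FRV.convexSum Y) (FRV.convexSum Z)
      = entropyOfDist p + ∑ x, p x * mutualInfo μ (Y x) (Z x) := by
  rw [mutualInfo, FRV.entropy_convexSum μ hp.1, FRV.entropy_convexSum μ hp.1,
    FRV.jointEntropy_convexSum μ hp.1]
  simp_rw [mutualInfo, mul_sub, mul_add, Finset.sum_sub_distrib, Finset.sum_add_distrib]
  ring
end

section
/- Let F be a map assigning a non-negative real number F(X,Y) to every ordered pair of finite random variables defined on a common probability space, and suppose F is continuous, strongly additive, symmetric, weakly functorial, invariant under pullbacks, and satisfies F(X,C) = 0 for every constant random variable C. Then the map ℰ defined on finite random variables by ℰ(X) = F(X,X) is a non-negative multiple of Shannon entropy: there exists c ≥ 0 such that F(X,X) = c·H(X) for all finite random variables X. -/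
open MeasureTheory Filter Topology

/-- A real linear inequality in a natural number parameter can be divided by the parameter. -/
theorem le_of_forall_nat_mul_le {x y C : ℝ} (h : ∀ n : ℕ, (n : ℝ) * x ≤ C + n * y) : x ≤ y := by
  by_contra! hlt
  obtain ⟨n, hn⟩ := exists_nat_gt (C / (x - y))
  rw [div_lt_iff₀ (sub_pos.2 hlt)] at hn
  linarith [h n]

theorem map_pow_of_mul {A : ℕ → ℝ}
    (hmul : ∀ m n, 0 < m → 0 < n → A (m * n) = A m + A n) {n : ℕ} (hn : 0 < n) (a : ℕ) :
    A (n ^ a) = a * A n := by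
  induction a with
  | zero =>
    have := hmul 1 1 one_pos one_pos
    simp only [mul_one] at this
    simp only [pow_zero, Nat.cast_zero, zero_mul]
    linarith
  | succ k ih =>
    rw [pow_succ, hmul _ _ (pow_pos hn k) hn, ih]
    push_cast
    ring

theorem mul_log_le_of_mul {A : ℕ → ℝ} (hA : ∀ n, 0 < n → 0 ≤ A n)
    (hmul : ∀ m n, 0 < m → 0 < n → A (m * n) = A m + A n)
    (hmono : ∀ n N : ℕ, 0 < n → n ≤ N → (n : ℝ) / N * A n ≤ A N) {m n : ℕ} (hm : 2 ≤ m)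
    (hn : 2 ≤ n) : A n * Real.log m ≤ A m * Real.log n := by
  have hm0 : 0 < m := by omega
  have hn0 : 0 < n := by omega
  have hm' : (0 : ℝ) < m := by exact_mod_cast hm0
  have hn' : (0 : ℝ) < n := by exact_mod_cast hn0
  have hlogm : 0 ≤ Real.log m := Real.log_natCast_nonneg m
  have key : ∀ K a : ℕ, 0 < K → (K : ℝ) / (K + 1) * (a * A n) * Real.log m ≤
      A m * (Real.log m + Real.log K + a * Real.log n) := by
    intro K a hK
    have hK' : (0 : ℝ) < K := by exact_mod_cast hK
    have hna : 0 < n ^ a := pow_pos hn0 a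
    set l := Nat.log m (K * n ^ a) with hl
    have hlow : m ^ l ≤ K * n ^ a := Nat.pow_log_le_self m (by positivity)
    have hhigh : K * n ^ a < m ^ (l + 1) := Nat.lt_pow_succ_log_self (by omega) _
    set M := m ^ (l + 1) with hM
    have hMpos : 0 < M := pow_pos hm0 _
    have hM' : (0 : ℝ) < M := by exact_mod_cast hMpos
    set q := M / n ^ a with hq
    have hKq : K ≤ q := (Nat.le_div_iff_mul_le hna).2 hhigh.le
    have hq0 : 0 < q := by omega
    have hqM : q * n ^ a ≤ M := Nat.div_mul_le_self _ _
    have hMq : M ≤ (q + 1) * n ^ a := by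
      have := Nat.lt_div_mul_add (a := M) hna
      rw [add_mul, one_mul]
      exact this.le
    have h1 := hmono (q * n ^ a) M (by positivity) hqM
    rw [hmul q _ hq0 hna, map_pow_of_mul hmul hn0] at h1
    rw [hM, map_pow_of_mul hmul hm0, ← hM] at h1
    have hfrac : (K : ℝ) / (K + 1) ≤ ((q * n ^ a : ℕ) : ℝ) / M := by
      rw [div_le_div_iff₀ (by positivity) hM']
      have e1 : (M : ℝ) ≤ (q + 1) * (n : ℝ) ^ a := by exact_mod_cast hMq
      have e2 : (K : ℝ) ≤ q := by exact_mod_cast hKq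
      push_cast
      have e3 : (0 : ℝ) < (n : ℝ) ^ a := by positivity
      calc (K : ℝ) * M ≤ K * ((q + 1) * (n : ℝ) ^ a) := by gcongr
        _ = (K * q + K) * (n : ℝ) ^ a := by ring
        _ ≤ (K * q + q) * (n : ℝ) ^ a := by gcongr
        _ = q * (n : ℝ) ^ a * (K + 1) := by ring
    have h2 : (K : ℝ) / (K + 1) * (a * A n) ≤ (l + 1 : ℕ) * A m := by
      refine le_trans ?_ h1
      have := hA q hq0
      have := hA n hn0
      gcongr
      linarith
    have h3 : (l : ℝ) * Real.log m ≤ Real.log K + a * Real.log n := by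
      have : ((m : ℝ) ^ l) ≤ K * (n : ℝ) ^ a := by exact_mod_cast hlow
      have := Real.log_le_log (by positivity) this
      rwa [Real.log_mul hK'.ne' (by positivity), Real.log_pow, Real.log_pow] at this
    calc (K : ℝ) / (K + 1) * (a * A n) * Real.log m
        ≤ (l + 1 : ℕ) * A m * Real.log m := by gcongr
      _ = A m * (Real.log m + l * Real.log m) := by push_cast; ring
      _ ≤ A m * (Real.log m + Real.log K + a * Real.log n) := by
        have := hA m hm0
        rw [add_assoc]
        gcongr
  refine le_of_forall_nat_mul_le (C := A m * Real.log n) fun K => ?_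
  rcases Nat.eq_zero_or_pos K with rfl | hK
  · simpa using mul_nonneg (hA m hm0) (Real.log_natCast_nonneg n)
  · have hK' : (0 : ℝ) < K + 1 := by positivity
    have : (K : ℝ) / (K + 1) * (A n * Real.log m) ≤ A m * Real.log n := by
      refine le_of_forall_nat_mul_le (C := A m * (Real.log m + Real.log K)) fun a => ?_
      have := key K a hK
      linarith
    rw [div_mul_eq_mul_div, div_le_iff₀ hK'] at this
    linarith

/-- A non-negative additive arithmetic function which is monotone up to the factor `n / N`
is a multiple of the logarithm. -/
theorem exists_eq_mul_log_of_mul {A : ℕ → ℝ} (hA : ∀ n, 0 < n → 0 ≤ A n)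
    (hmul : ∀ m n, 0 < m → 0 < n → A (m * n) = A m + A n)
    (hmono : ∀ n N : ℕ, 0 < n → n ≤ N → (n : ℝ) / N * A n ≤ A N) :
    ∃ c : ℝ, 0 ≤ c ∧ ∀ n, 0 < n → A n = c * Real.log n := by
  have hlog2 : 0 < Real.log 2 := Real.log_pos one_lt_two
  refine ⟨A 2 / Real.log 2, div_nonneg (hA 2 two_pos) hlog2.le, fun n hn => ?_⟩
  rcases Nat.lt_or_ge n 2 with h | h
  · obtain rfl : n = 1 := by omega
    have := map_pow_of_mul hmul one_pos 0
    simpa using this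
  · have h1 := mul_log_le_of_mul hA hmul hmono le_rfl h
    have h2 := mul_log_le_of_mul hA hmul hmono h le_rfl
    rw [div_mul_eq_mul_div, eq_div_iff hlog2.ne']
    push_cast at h1 h2
    exact le_antisymm h1 h2

namespace FRV

/-- The identity of a discrete finite probability space. -/
def discId (α : Type) [Fintype α] : @FRV α ⊤ :=
  let _ : MeasurableSpace α := ⊤
  { α := α, fintype := inferInstance, X := id, meas := fun _ => trivial }

theorem discMeasure_singleton_s16 {α : Type} [Fintype α] [MeasurableSpace α]
    [MeasurableSingletonClass α] (p : α → ℝ) (a : α) :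
    discMeasure p {a} = ENNReal.ofReal (p a) := by
  classical
  rw [discMeasure, Measure.sum_apply _ (measurableSet_singleton a), tsum_fintype]
  simp [Set.indicator_apply]

theorem isProbabilityMeasure_discMeasure {α : Type} [Fintype α] [MeasurableSpace α]
    {p : α → ℝ} (hp : IsProbDist p) : IsProbabilityMeasure (discMeasure p) := by
  constructor
  rw [discMeasure, Measure.sum_apply _ MeasurableSet.univ, tsum_fintype]
  simp [← ENNReal.ofReal_sum_of_nonneg fun a _ => hp.1 a, hp.2]

variable {Ω : Type} [MeasurableSpace Ω]

theorem measurable_top (X : FRV Ω) : @Measurable Ω X.α _ ⊤ X.X :=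
  let _ : MeasurableSpace X.α := ⊤
  measurable_to_countable' X.meas

theorem measurePreserving_discMeasure (μ : Measure Ω) [IsProbabilityMeasure μ] (X : FRV Ω) :
    let _ : MeasurableSpace X.α := ⊤
    MeasurePreserving X.X μ (discMeasure (X.pmf μ)) := by
  let _ : MeasurableSpace X.α := ⊤
  let _ : MeasurableSingletonClass X.α := ⟨fun _ => MeasurableSpace.measurableSet_top⟩
  refine ⟨X.measurable_top, Measure.ext_of_singleton fun a => ?_⟩
  rw [discMeasure_singleton_s16, Measure.map_apply X.measurable_top (measurableSet_singleton a), pmf,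
    ENNReal.ofReal_toReal (measure_ne_top _ _)]

theorem isProbDist_pmf (μ : Measure Ω) [IsProbabilityMeasure μ] (X : FRV Ω) :
    IsProbDist (X.pmf μ) := by
  refine ⟨fun _ => ENNReal.toReal_nonneg, ?_⟩
  have h := sum_measureReal_preimage_singleton (μ := μ) (f := X.X) Finset.univ fun a _ => X.meas a
  change ∑ b, (μ (X.X ⁻¹' {b})).toReal = 1
  simpa [Measure.real] using h

theorem condDist_eq_one {μ : Measure Ω} {X Y : FRV Ω} {a : X.α} {b : Y.α} (ha : X.pmf μ a ≠ 0)
    (hab : X.X ⁻¹' {a} ⊆ Y.X ⁻¹' {b}) : condDist μ X Y a b = 1 := by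
  unfold condDist jointDist
  rw [if_pos ha, Set.inter_eq_left.2 hab]
  exact div_self ha

theorem isMarkovTriangle_map_const (μ : Measure Ω) [IsProbabilityMeasure μ] (X : FRV Ω)
    {β : Type} [Fintype β] (f : X.α → β) :
    IsMarkovTriangle μ X (X.map f) (X.map fun _ => ()) := by
  refine ⟨fun zx => f zx.2, fun z x => ?_⟩
  by_cases hx : X.pmf μ x = 0
  · simp [condDist, hx]
  · have hsub : X.X ⁻¹' {x} ⊆ (X.map f).X ⁻¹' {f x} := fun ω hω => congrArg f hω
    have hpos : 0 < X.pmf μ x := lt_of_le_of_ne ENNReal.toReal_nonneg (Ne.symm hx)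
    have hfx : (X.map f).pmf μ (f x) ≠ 0 :=
      (hpos.trans_le (ENNReal.toReal_mono (measure_ne_top _ _) (measure_mono hsub))).ne'
    have hX : condDist μ X (X.map fun _ => ()) x z = 1 := condDist_eq_one hx fun _ _ => rfl
    have hfX : condDist μ (X.map f) (X.map fun _ => ()) (f x) z = 1 :=
      condDist_eq_one hfx fun _ _ => rfl
    rw [hX, hfX, condDist_eq_one hx hsub, one_mul]

/-- Finite distributions can be realized simultaneously on one probability space. -/
theorem exists_family {ι : Type} (α : ι → Type) [∀ i, Fintype (α i)] (p : ∀ i, α i → ℝ)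
    (hp : ∀ i, IsProbDist (p i)) :
    ∃ (Ω : Type) (_ : MeasurableSpace Ω) (μ : Measure Ω) (_ : IsProbabilityMeasure μ)
      (X : ∀ i, Ω → α i) (_ : ∀ i a, MeasurableSet (X i ⁻¹' {a})),
      ∀ i a, (μ (X i ⁻¹' {a})).toReal = p i a := by
  let _ : ∀ i, MeasurableSpace (α i) := fun _ => ⊤
  have _ : ∀ i, MeasurableSingletonClass (α i) :=
    fun _ => ⟨fun _ => MeasurableSpace.measurableSet_top⟩
  have _ := fun i => isProbabilityMeasure_discMeasure (hp i)
  refine ⟨∀ i, α i, inferInstance, Measure.infinitePi fun i => discMeasure (p i), inferInstance,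
    fun i => Function.eval i, fun i a => measurable_pi_apply i (measurableSet_singleton a),
    fun i a => ?_⟩
  rw [(measurePreserving_eval_infinitePi (fun i => discMeasure (p i)) i).measure_preimage
    (measurableSet_singleton a).nullMeasurableSet, discMeasure_singleton_s16,
    ENNReal.toReal_ofReal ((hp i).1 a)]

end FRV

namespace PF

variable {F : PairFunctional}

/-- The value of `F` on the diagonal, as a function of a distribution on a finite set. -/
noncomputable def diag (F : PairFunctional) {α : Type} [Fintype α] (p : α → ℝ) : ℝ :=
  let _ : MeasurableSpace α := ⊤
  F α (FRV.discMeasure p) (FRV.discId α) (FRV.discId α)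

theorem apply_self_eq_diag (h5 : PullbackInvariant F) {Ω : Type} [MeasurableSpace Ω]
    (μ : Measure Ω) [IsProbabilityMeasure μ] (X : FRV Ω) : F Ω μ X X = diag F (X.pmf μ) := by
  let _ : MeasurableSpace X.α := ⊤
  have := FRV.isProbabilityMeasure_discMeasure (FRV.isProbDist_pmf μ X)
  exact (h5 X.α Ω (FRV.discMeasure (X.pmf μ)) μ X.X (FRV.measurePreserving_discMeasure μ X)
    (FRV.discId X.α) (FRV.discId X.α)).symm

theorem diag_nonneg (h0 : Nonneg F) {α : Type} [Fintype α] {p : α → ℝ} (hp : IsProbDist p) :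
    0 ≤ diag F p := by
  let _ : MeasurableSpace α := ⊤
  have := FRV.isProbabilityMeasure_discMeasure hp
  exact h0 _ _ _ _

theorem apply_map_right (h4 : WeaklyFunctorial F) (h6 : VanishesOnConstants F)
    {Ω : Type} [MeasurableSpace Ω] (μ : Measure Ω) [IsProbabilityMeasure μ] (X : FRV Ω)
    {β : Type} [Fintype β] (f : X.α → β) :
    F Ω μ X (X.map f) = F Ω μ (X.map f) (X.map f) := by
  have h := h4 Ω μ _ _ _ (FRV.isMarkovTriangle_map_const μ X f)
  have hC : (X.map fun _ => ()).IsConstant := fun a b => Subsingleton.elim (α := Unit) a b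
  rw [h6 Ω μ _ _ hC, h6 Ω μ _ _ hC] at h
  linarith

theorem apply_map_equiv (h3 : Symm F) (h4 : WeaklyFunctorial F) (h6 : VanishesOnConstants F)
    {Ω : Type} [MeasurableSpace Ω] (μ : Measure Ω) [IsProbabilityMeasure μ] (X : FRV Ω)
    {β : Type} [Fintype β] (f : X.α ≃ β) :
    F Ω μ (X.map f) (X.map f) = F Ω μ X X := by
  have h1 := apply_map_right h4 h6 μ X f
  have h2 := apply_map_right h4 h6 μ (X.map f) f.symm
  have hX : (X.map f).map f.symm = X := by
    obtain ⟨α, _, X, _⟩ := X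
    simp only [FRV.map, FRV.mk.injEq, heq_eq_eq, true_and]
    funext ω
    simp
  rw [hX] at h2
  rw [← h1, h3, h2]

theorem pmf_discId {α : Type} [Fintype α] {p : α → ℝ} (hp : IsProbDist p) :
    let _ : MeasurableSpace α := ⊤
    (FRV.discId α).pmf (FRV.discMeasure p) = p := by
  let _ : MeasurableSpace α := ⊤
  let _ : MeasurableSingletonClass α := ⟨fun _ => MeasurableSpace.measurableSet_top⟩
  funext a
  exact (congrArg ENNReal.toReal (FRV.discMeasure_singleton_s16 p a)).trans
    (ENNReal.toReal_ofReal (hp.1 a))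

theorem diag_comp_equiv (h3 : Symm F) (h4 : WeaklyFunctorial F) (h5 : PullbackInvariant F)
    (h6 : VanishesOnConstants F) {α β : Type} [Fintype α] [Fintype β] (f : α ≃ β)
    {p : β → ℝ} (hp : IsProbDist p) : diag F (p ∘ f) = diag F p := by
  let _ : MeasurableSpace β := ⊤
  let _ : MeasurableSingletonClass β := ⟨fun _ => MeasurableSpace.measurableSet_top⟩
  have := FRV.isProbabilityMeasure_discMeasure hp
  have h := apply_map_equiv h3 h4 h6 (FRV.discMeasure p) (FRV.discId β) f.symm
  rw [apply_self_eq_diag h5, apply_self_eq_diag h5, pmf_discId hp] at h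
  have hpf : ((FRV.discId β).map f.symm).pmf (FRV.discMeasure p) = p ∘ f := by
    funext a
    have hset : f.symm ⁻¹' {a} = {f a} := by
      ext b
      exact f.symm_apply_eq
    have e : (FRV.discMeasure p (f.symm ⁻¹' {a})).toReal = p (f a) := by
      rw [hset, FRV.discMeasure_singleton_s16, ENNReal.toReal_ofReal (hp.1 _)]
    exact e
  exact (congrArg (diag F (α := α)) hpf).symm.trans h

theorem diag_sigma (h2 : StronglyAdditive F) (h5 : PullbackInvariant F) {α : Type} [Fintype α]
    {β : α → Type} [∀ a, Fintype (β a)] {p : α → ℝ} (hp : IsProbDist p)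
    {q : ∀ a, β a → ℝ} (hq : ∀ a, IsProbDist (q a)) :
    diag F (fun s : Σ a, β a => p s.1 * q s.1 s.2) = diag F p + ∑ a, p a * diag F (q a) := by
  let γ : Option α → Type := fun o => o.elim α β
  let inst : ∀ o, Fintype (γ o) := fun o => Option.rec (motive := fun o => Fintype (γ o))
    ‹Fintype α› ‹∀ a, Fintype (β a)› o
  let r : ∀ o, γ o → ℝ := fun o => Option.rec (motive := fun o => γ o → ℝ) p q o
  have hr : ∀ o, IsProbDist (r o) := fun o =>
    Option.rec (motive := fun o => IsProbDist (r o)) hp hq o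
  obtain ⟨Ω, _, μ, _, W, hW, hWr⟩ := FRV.exists_family γ r hr
  let X : FRV Ω := ⟨α, inferInstance, W none, hW none⟩
  let Y : α → FRV Ω := fun a => ⟨β a, inferInstance, W (some a), hW (some a)⟩
  have hX : X.pmf μ = p := funext fun a => hWr none a
  have hY : ∀ a, (Y a).pmf μ = q a := fun a => funext fun b => hWr (some a) b
  let _ : MeasurableSpace α := ⊤
  have _ : MeasurableSingletonClass α := ⟨fun _ => MeasurableSpace.measurableSet_top⟩
  have _ := FRV.isProbabilityMeasure_discMeasure hp
  have h : F (α × Ω) ((FRV.discMeasure (X.pmf μ)).prod μ) (FRV.convexSum Y) (FRV.convexSum Y)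
      = F Ω μ X X + ∑ a : α, X.pmf μ a * F Ω μ (Y a) (Y a) := h2 Ω μ X Y Y
  simp only [apply_self_eq_diag h5 μ] at h
  rw [hX, apply_self_eq_diag h5] at h
  simp only [hY] at h
  have hpmf : (FRV.convexSum Y).pmf ((FRV.discMeasure p).prod μ) =
      fun s : Σ a, β a => p s.1 * q s.1 s.2 := by
    funext s
    obtain ⟨a, b⟩ := s
    have hset : (FRV.convexSum Y).X ⁻¹' {(⟨a, b⟩ : Σ a, β a)} = {a} ×ˢ ((Y a).X ⁻¹' {b}) := by
      ext ⟨x, ω⟩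
      change (⟨x, (Y x).X ω⟩ : Σ a, β a) = ⟨a, b⟩ ↔ x = a ∧ (Y a).X ω = b
      rw [Sigma.mk.injEq]
      constructor
      · rintro ⟨rfl, e⟩
        exact ⟨rfl, eq_of_heq e⟩
      · rintro ⟨rfl, e⟩
        exact ⟨rfl, heq_of_eq e⟩
    have e : (((FRV.discMeasure p).prod μ) ((FRV.convexSum Y).X ⁻¹' {(⟨a, b⟩ : Σ a, β a)})).toReal
        = p a * q a b := by
      rw [hset, Measure.prod_prod, FRV.discMeasure_singleton_s16, ENNReal.toReal_mul,
        ENNReal.toReal_ofReal (hp.1 a)]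
      exact congrArg (p a * ·) (congrFun (hY a) b)
    exact e
  rw [hpmf] at h
  exact h

theorem tendsto_diag (h1 : PF.Continuous F) (h5 : PullbackInvariant F) {α : Type} [Fintype α]
    {p : ℕ → α → ℝ} {q : α → ℝ} (hp : ∀ n, IsProbDist (p n)) (hq : IsProbDist q)
    (h : ∀ a, Tendsto (fun n => p n a) atTop (𝓝 (q a))) :
    Tendsto (fun n => diag F (p n)) atTop (𝓝 (diag F q)) := by
  classical
  let r : Option ℕ → α → ℝ := fun o => o.elim q p
  have hr : ∀ o, IsProbDist (r o)
    | none => hq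
    | some n => hp n
  obtain ⟨Ω, _, μ, _, W, hW, hWr⟩ := FRV.exists_family (fun _ => α) r hr
  let Y : Option ℕ → FRV Ω := fun o => ⟨α, inferInstance, W o, hW o⟩
  have hY : ∀ o, (Y o).pmf μ = r o := fun o => funext fun a => hWr o a
  have hYY : ∀ (o : Option ℕ) (a b : α),
      ((Y o).prod (Y o)).pmf μ (a, b) = if a = b then r o a else 0 := by
    intro o a b
    have hset : ((Y o).prod (Y o)).X ⁻¹' {((a, b) : α × α)} = W o ⁻¹' {a} ∩ W o ⁻¹' {b} := by
      ext ω
      change (W o ω, W o ω) = (a, b) ↔ W o ω = a ∧ W o ω = b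
      rw [Prod.mk.injEq]
    have e : (μ (((Y o).prod (Y o)).X ⁻¹' {((a, b) : α × α)})).toReal
        = if a = b then r o a else 0 := by
      rw [hset]
      split_ifs with hab
      · rw [← hab, Set.inter_self, hWr]
      · have : W o ⁻¹' {a} ∩ W o ⁻¹' {b} = ∅ := by
          ext ω
          simp only [Set.mem_inter_iff, Set.mem_preimage, Set.mem_singleton_iff,
            Set.mem_empty_iff_false, iff_false, not_and]
          rintro rfl
          exact hab
        rw [this, measure_empty, ENNReal.toReal_zero]
    exact e
  have hconv : FRV.WeakConvPair μ (fun n => Y (some n)) (fun n => Y (some n)) (Y none)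
      (Y none) := by
    refine ⟨⟨0, fun _ _ => rfl⟩, ?_⟩
    rintro ⟨a, b⟩
    rw [hYY none a b]
    refine Tendsto.congr (f₁ := fun n => if a = b then p n a else 0) (fun n => ?_) ?_
    · exact ((dif_pos rfl).trans (hYY (some n) a b)).symm
    · split_ifs
      · exact h a
      · exact tendsto_const_nhds
  have hlim := h1 Ω μ _ _ _ _ hconv
  simp only [apply_self_eq_diag h5 μ, hY] at hlim
  exact hlim

/-- The value of `F` on the diagonal at a uniform distribution on `n` points. -/
noncomputable def diagUniform (F : PairFunctional) (n : ℕ) : ℝ :=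
  diag F fun _ : Fin n => (n : ℝ)⁻¹

theorem isProbDist_uniform {n : ℕ} (hn : 0 < n) : IsProbDist fun _ : Fin n => (n : ℝ)⁻¹ := by
  refine ⟨fun _ => by positivity, ?_⟩
  have : (n : ℝ) ≠ 0 := by positivity
  simp [this]

theorem isProbDist_div_sum {α : Type} [Fintype α] [Nonempty α] {k : α → ℕ}
    (hk : ∀ a, 0 < k a) : IsProbDist fun a => (k a : ℝ) / (∑ b, k b : ℕ) := by
  refine ⟨fun _ => by positivity, ?_⟩
  have : 0 < ∑ b, k b := Finset.sum_pos (fun a _ => hk a) Finset.univ_nonempty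
  rw [← Finset.sum_div, ← Nat.cast_sum]
  exact div_self (by positivity)

/-- Splitting a uniform distribution into blocks of prescribed sizes. -/
theorem diagUniform_sum (h2 : StronglyAdditive F) (h3 : Symm F) (h4 : WeaklyFunctorial F)
    (h5 : PullbackInvariant F) (h6 : VanishesOnConstants F) {α : Type} [Fintype α] [Nonempty α]
    {k : α → ℕ} (hk : ∀ a, 0 < k a) :
    diagUniform F (∑ a, k a) = diag F (fun a => (k a : ℝ) / (∑ b, k b : ℕ)) +
      ∑ a, (k a : ℝ) / (∑ b, k b : ℕ) * diagUniform F (k a) := by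
  have hpos : 0 < ∑ b, k b := Finset.sum_pos (fun a _ => hk a) Finset.univ_nonempty
  have h := diag_sigma h2 h5 (isProbDist_div_sum hk) fun a => isProbDist_uniform (hk a)
  refine Eq.trans ?_ h
  have e : (Σ a, Fin (k a)) ≃ Fin (∑ a, k a) := Fintype.equivFinOfCardEq (by simp)
  rw [diagUniform, ← diag_comp_equiv h3 h4 h5 h6 e (isProbDist_uniform hpos)]
  congr 1
  funext s
  have h0 : (k s.1 : ℝ) ≠ 0 := by exact_mod_cast (hk s.1).ne'
  have h1 : ((∑ b, k b : ℕ) : ℝ) ≠ 0 := by exact_mod_cast hpos.ne'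
  simp only [Function.comp_apply]
  field_simp

theorem diagUniform_nonneg (h0 : Nonneg F) (n : ℕ) (hn : 0 < n) : 0 ≤ diagUniform F n :=
  diag_nonneg h0 (isProbDist_uniform hn)

theorem diagUniform_mul (h2 : StronglyAdditive F) (h3 : Symm F) (h4 : WeaklyFunctorial F)
    (h5 : PullbackInvariant F) (h6 : VanishesOnConstants F) (m n : ℕ) (hm : 0 < m)
    (hn : 0 < n) : diagUniform F (m * n) = diagUniform F m + diagUniform F n := by
  have : Nonempty (Fin m) := ⟨⟨0, hm⟩⟩
  have h := diagUniform_sum h2 h3 h4 h5 h6 (k := fun _ : Fin m => n) fun _ => hn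
  simp only [Finset.sum_const, Finset.card_univ, Fintype.card_fin, smul_eq_mul, nsmul_eq_mul,
    Nat.cast_mul] at h
  have hm' : (m : ℝ) ≠ 0 := by positivity
  have hn' : (n : ℝ) ≠ 0 := by positivity
  have e1 : (n : ℝ) / (m * n) = (m : ℝ)⁻¹ := by field_simp
  rw [e1] at h
  rw [h, ← mul_assoc, mul_inv_cancel₀ hm', one_mul]
  rfl

theorem div_mul_diagUniform_le (h0 : Nonneg F) (h2 : StronglyAdditive F) (h3 : Symm F)
    (h4 : WeaklyFunctorial F) (h5 : PullbackInvariant F) (h6 : VanishesOnConstants F)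
    (n N : ℕ) (hn : 0 < n) (hnN : n ≤ N) :
    (n : ℝ) / N * diagUniform F n ≤ diagUniform F N := by
  rcases hnN.eq_or_lt with rfl | hlt
  · rw [div_self (by positivity), one_mul]
  · have hk : ∀ b : Bool, 0 < bif b then n else N - n := by
      intro b
      cases b
      · exact Nat.sub_pos_of_lt hlt
      · exact hn
    have h := diagUniform_sum h2 h3 h4 h5 h6 hk
    have hsum : ∑ b : Bool, (bif b then n else N - n) = N := by
      rw [Fintype.sum_bool]
      exact Nat.add_sub_cancel' hnN
    have h' := diag_nonneg h0 (isProbDist_div_sum hk)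
    rw [hsum] at h h'
    rw [h, Fintype.sum_bool]
    have hr := diagUniform_nonneg h0 _ (Nat.sub_pos_of_lt hlt)
    have : 0 ≤ ((N - n : ℕ) : ℝ) / N * diagUniform F (N - n) := by positivity
    simp only [cond_true, cond_false]
    linarith

theorem diag_div_sum (h2 : StronglyAdditive F) (h3 : Symm F) (h4 : WeaklyFunctorial F)
    (h5 : PullbackInvariant F) (h6 : VanishesOnConstants F) {c : ℝ}
    (hc : ∀ n, 0 < n → diagUniform F n = c * Real.log n) {α : Type} [Fintype α] [Nonempty α]
    {k : α → ℕ} (hk : ∀ a, 0 < k a) :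
    diag F (fun a => (k a : ℝ) / (∑ b, k b : ℕ)) =
      c * entropyOfDist fun a => (k a : ℝ) / (∑ b, k b : ℕ) := by
  have hpos : 0 < ∑ b, k b := Finset.sum_pos (fun a _ => hk a) Finset.univ_nonempty
  have h := diagUniform_sum h2 h3 h4 h5 h6 hk
  have hone := (isProbDist_div_sum hk).2
  set S := ∑ b, k b with hS
  have hS' : (S : ℝ) ≠ 0 := by positivity
  have hterm : ∀ a, (k a : ℝ) / S * Real.log ((k a : ℝ) / S) =
      (k a : ℝ) / S * Real.log (k a) - (k a : ℝ) / S * Real.log S := by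
    intro a
    have : (k a : ℝ) ≠ 0 := by exact_mod_cast (hk a).ne'
    rw [Real.log_div this hS', mul_sub]
  have hsum : ∑ a, (k a : ℝ) / S * diagUniform F (k a) =
      c * ∑ a, (k a : ℝ) / S * Real.log (k a) := by
    rw [Finset.mul_sum]
    refine Finset.sum_congr rfl fun a _ => ?_
    rw [hc _ (hk a)]
    ring
  rw [entropyOfDist, Finset.sum_congr rfl fun a _ => hterm a, Finset.sum_sub_distrib,
    ← Finset.sum_mul, hone]
  rw [hc S hpos, hsum] at h
  linarith

end PF

theorem tendsto_entropyOfDist {α : Type} [Fintype α] {p : ℕ → α → ℝ} {q : α → ℝ}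
    (h : ∀ a, Tendsto (fun n => p n a) atTop (𝓝 (q a))) :
    Tendsto (fun n => entropyOfDist (p n)) atTop (𝓝 (entropyOfDist q)) :=
  (tendsto_finsetSum _ fun a _ => (Real.continuous_mul_log.tendsto _).comp (h a)).neg

/-- Every distribution is a limit of distributions with positive rational weights. -/
theorem tendsto_floor_add_one_div_sum {α : Type} [Fintype α] {p : α → ℝ} (hp : IsProbDist p)
    (a : α) :
    Tendsto (fun n : ℕ => ((⌊p a * n⌋₊ + 1 : ℕ) : ℝ) / (∑ b, (⌊p b * n⌋₊ + 1) : ℕ)) atTop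
      (𝓝 (p a)) := by
  have hlim : ∀ b, Tendsto (fun n : ℕ => ((⌊p b * n⌋₊ + 1 : ℕ) : ℝ) / n) atTop (𝓝 (p b)) := by
    intro b
    have h1 := (tendsto_nat_floor_mul_div_atTop (hp.1 b)).comp
      (tendsto_natCast_atTop_atTop (R := ℝ))
    have h2 := h1.add (tendsto_one_div_atTop_nhds_zero_nat (𝕜 := ℝ))
    rw [add_zero] at h2
    refine h2.congr fun n => ?_
    simp [add_div]
  have hsum := tendsto_finsetSum Finset.univ fun b _ => hlim b
  rw [hp.2] at hsum
  have h := (hlim a).div hsum one_ne_zero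
  rw [div_one] at h
  refine h.congr' ?_
  filter_upwards [eventually_gt_atTop 0] with n hn
  have hn' : (n : ℝ) ≠ 0 := by positivity
  simp only [Pi.div_apply]
  rw [← Finset.sum_div, ← Nat.cast_sum, div_div_div_cancel_right₀ hn']

/-- If `F` is a non-negative, continuous, strongly additive, symmetric,
weakly functorial, pullback-invariant map on pairs of finite random variables which
vanishes on constants, then `ℰ(X) = F(X,X)` is a non-negative multiple of Shannon
entropy. -/
theorem diagonal_is_entropy (F : PairFunctional) (h0 : PF.Nonneg F)
    (h1 : PF.Continuous F) (h2 : PF.StronglyAdditive F) (h3 : PF.Symm F)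
    (h4 : PF.WeaklyFunctorial F) (h5 : PF.PullbackInvariant F)
    (h6 : PF.VanishesOnConstants F) :
    ∃ c : ℝ, 0 ≤ c ∧ ∀ (Ω : Type) [MeasurableSpace Ω] (μ : Measure Ω)
      [IsProbabilityMeasure μ] (X : FRV Ω), F Ω μ X X = c * X.entropy μ := by
  obtain ⟨c, hc0, hc⟩ := exists_eq_mul_log_of_mul
    (PF.diagUniform_nonneg h0) (PF.diagUniform_mul h2 h3 h4 h5 h6)
    (PF.div_mul_diagUniform_le h0 h2 h3 h4 h5 h6)
  refine ⟨c, hc0, fun Ω _ μ _ X => ?_⟩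
  have hp := X.isProbDist_pmf μ
  have : Nonempty X.α := (nonempty_of_isProbabilityMeasure μ).map X.X
  have hk : ∀ (n : ℕ) (a : X.α), 0 < ⌊X.pmf μ a * n⌋₊ + 1 := fun _ _ => Nat.succ_pos _
  have h1' := PF.tendsto_diag h1 h5 (fun n => PF.isProbDist_div_sum (hk n)) hp
    (tendsto_floor_add_one_div_sum hp)
  have h2' := (tendsto_entropyOfDist (tendsto_floor_add_one_div_sum hp)).const_mul c
  rw [PF.apply_self_eq_diag h5]
  refine tendsto_nhds_unique h1' (h2'.congr fun n => ?_)
  exact (PF.diag_div_sum h2 h3 h4 h5 h6 hc (hk n)).symm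
end
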